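/- In the classical sequent calculus with identity extended by the binary quantifier I with rules (RI^C), (LI^{C1}), (LI^{C2}), for all formulas F, G the sequent ⇒ Ix[F,G] ↔ ∃y(∀x(F↔x=y)∧G[y/x]) (with empty antecedent, y a variable not occurring in F or G) is provable. -/

import Mathlib

/-!
Deep embedding of a classical first-order language with identity and the
binary quantifier `I` for definite descriptions (`Ix[F,G]`, "the F is G"),
and of the classical sequent calculus with identity extended by the rules
(RI^C), (LI^{C1}), (LI^{C2}) for `I`.  Bound variables are de Bruijn
indices, free variables are "parameters" (natural numbers).
-/

/-- A first-order signature: function symbols and predicate symbols with arities. -/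
structure Sig where
  Fn : Type
  fnAr : Fn → ℕ
  Pr : Type
  prAr : Pr → ℕ

/-- Terms: parameters, constants, (de Bruijn) bound variables and function terms. -/
inductive Tm (σ : Sig) : Type
  | par : ℕ → Tm σ
  | const : ℕ → Tm σ
  | bvar : ℕ → Tm σ
  | func : (f : σ.Fn) → (Fin (σ.fnAr f) → Tm σ) → Tm σ

namespace Tm

variable {σ : Sig}

/-- Lift (shift up by one) the bound variables `≥ c`. -/
def lift (c : ℕ) : Tm σ → Tm σ
  | par a => par a
  | const k => const k
  | bvar n => if n < c then bvar n else bvar (n + 1)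
  | func f ts => func f fun i => (ts i).lift c

/-- Substitute the term `u` for the bound variable `k`. -/
def inst (k : ℕ) (u : Tm σ) : Tm σ → Tm σ
  | par a => par a
  | const c => const c
  | bvar n => if n = k then u else if k < n then bvar (n - 1) else bvar n
  | func f ts => func f fun i => inst k u (ts i)

/-- Substitute the term `u` for the parameter `a`. -/
def substPar (a : ℕ) (u : Tm σ) : Tm σ → Tm σ
  | par b => if b = a then u else par b
  | const c => const c
  | bvar n => bvar n
  | func f ts => func f fun i => substPar a u (ts i)

/-- The set of parameters occurring in a term. -/
def pars : Tm σ → Set ℕ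
  | par a => {a}
  | const _ => ∅
  | bvar _ => ∅
  | func _ ts => ⋃ i, (ts i).pars

/-- A term is `ClosedB` if it contains no (dangling) bound variables; genuine
terms of the language are of this kind, and such a term is automatically
free for any variable in any formula. -/
def ClosedB : Tm σ → Prop
  | par _ => True
  | const _ => True
  | bvar _ => False
  | func _ ts => ∀ i, (ts i).ClosedB

end Tm

/-- Formulas of the classical language (no existence predicate), including
the binary quantifier `iq F G` (`Ix[F,G]`), which binds the de Bruijn
variable `0` in both `F` and `G`. -/
inductive Fml (σ : Sig) : Type
  | atom : (p : σ.Pr) → (Fin (σ.prAr p) → Tm σ) → Fml σ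
  | eq : Tm σ → Tm σ → Fml σ
  | neg : Fml σ → Fml σ
  | conj : Fml σ → Fml σ → Fml σ
  | disj : Fml σ → Fml σ → Fml σ
  | imp : Fml σ → Fml σ → Fml σ
  | all : Fml σ → Fml σ
  | ex : Fml σ → Fml σ
  | iq : Fml σ → Fml σ → Fml σ

namespace Fml

variable {σ : Sig}

/-- Lift (shift up by one) the bound variables `≥ c`. -/
def lift (c : ℕ) : Fml σ → Fml σ
  | atom p ts => atom p fun i => (ts i).lift c
  | eq t s => eq (t.lift c) (s.lift c)
  | neg A => neg (A.lift c)
  | conj A B => conj (A.lift c) (B.lift c)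
  | disj A B => disj (A.lift c) (B.lift c)
  | imp A B => imp (A.lift c) (B.lift c)
  | all A => all (A.lift (c + 1))
  | ex A => ex (A.lift (c + 1))
  | iq F G => iq (F.lift (c + 1)) (G.lift (c + 1))

/-- Substitute the term `u` for the bound variable `k`. -/
def inst (k : ℕ) (u : Tm σ) : Fml σ → Fml σ
  | atom p ts => atom p fun i => Tm.inst k u (ts i)
  | eq t s => eq (Tm.inst k u t) (Tm.inst k u s)
  | neg A => neg (A.inst k u)
  | conj A B => conj (A.inst k u) (B.inst k u)
  | disj A B => disj (A.inst k u) (B.inst k u)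
  | imp A B => imp (A.inst k u) (B.inst k u)
  | all A => all (A.inst (k + 1) (u.lift 0))
  | ex A => ex (A.inst (k + 1) (u.lift 0))
  | iq F G => iq (F.inst (k + 1) (u.lift 0)) (G.inst (k + 1) (u.lift 0))

/-- `A.inst0 t` is `A[t/x]`: the result of substituting `t` for the
outermost bound variable `x` (de Bruijn index 0) of `A`. -/
def inst0 (A : Fml σ) (u : Tm σ) : Fml σ := A.inst 0 u

/-- Substitute the term `u` for the parameter `a`. -/
def substPar (a : ℕ) (u : Tm σ) : Fml σ → Fml σ
  | atom p ts => atom p fun i => Tm.substPar a u (ts i)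
  | eq t s => eq (Tm.substPar a u t) (Tm.substPar a u s)
  | neg A => neg (A.substPar a u)
  | conj A B => conj (A.substPar a u) (B.substPar a u)
  | disj A B => disj (A.substPar a u) (B.substPar a u)
  | imp A B => imp (A.substPar a u) (B.substPar a u)
  | all A => all (A.substPar a u)
  | ex A => ex (A.substPar a u)
  | iq F G => iq (F.substPar a u) (G.substPar a u)

/-- The set of parameters occurring in a formula. -/
def pars : Fml σ → Set ℕ
  | atom _ ts => ⋃ i, (ts i).pars
  | eq t s => t.pars ∪ s.pars
  | neg A => A.pars
  | conj A B => A.pars ∪ B.pars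
  | disj A B => A.pars ∪ B.pars
  | imp A B => A.pars ∪ B.pars
  | all A => A.pars
  | ex A => A.pars
  | iq F G => F.pars ∪ G.pars

/-- The degree of a formula: the number of logical operators occurring in it. -/
def deg : Fml σ → ℕ
  | atom _ _ => 0
  | eq _ _ => 0
  | neg A => A.deg + 1
  | conj A B => A.deg + B.deg + 1
  | disj A B => A.deg + B.deg + 1
  | imp A B => A.deg + B.deg + 1
  | all A => A.deg + 1
  | ex A => A.deg + 1
  | iq F G => F.deg + G.deg + 1

/-- Atomic formulas: predications and identities. -/
def Atomic : Fml σ → Prop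
  | atom _ _ => True
  | eq _ _ => True
  | _ => False

/-- `A ↔ B` abbreviates `(A → B) ∧ (B → A)`. -/
def iff (A B : Fml σ) : Fml σ := conj (imp A B) (imp B A)

end Fml

/-- The parameter `a` does not occur in any formula of `Γ`. -/
def FreshM {σ : Sig} (a : ℕ) (Γ : Multiset (Fml σ)) : Prop := ∀ B ∈ Γ, a ∉ B.pars

/-- Derivability in the classical sequent calculus with identity, extended by
the rules (RI^C), (LI^{C1}), (LI^{C2}) for the binary quantifier `I`.  The
parameter `P` constrains the cut formulas: every cut formula must satisfy
`P` (so `fun _ => True` puts no constraint and `fun _ => False` means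
cut-free). -/
inductive DerC (σ : Sig) (P : Fml σ → Prop) :
    Multiset (Fml σ) → Multiset (Fml σ) → Prop
  | ax (A : Fml σ) : DerC σ P {A} {A}
  | cut {Γ Θ Δ Λ : Multiset (Fml σ)} (A : Fml σ) :
      DerC σ P Γ (A ::ₘ Θ) → DerC σ P (A ::ₘ Δ) Λ → P A →
      DerC σ P (Γ + Δ) (Θ + Λ)
  | lw {Γ Δ : Multiset (Fml σ)} (A : Fml σ) :
      DerC σ P Γ Δ → DerC σ P (A ::ₘ Γ) Δ
  | rw {Γ Δ : Multiset (Fml σ)} (A : Fml σ) :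
      DerC σ P Γ Δ → DerC σ P Γ (A ::ₘ Δ)
  | lc {Γ Δ : Multiset (Fml σ)} (A : Fml σ) :
      DerC σ P (A ::ₘ A ::ₘ Γ) Δ → DerC σ P (A ::ₘ Γ) Δ
  | rc {Γ Δ : Multiset (Fml σ)} (A : Fml σ) :
      DerC σ P Γ (A ::ₘ A ::ₘ Δ) → DerC σ P Γ (A ::ₘ Δ)
  | lneg {Γ Δ : Multiset (Fml σ)} (A : Fml σ) :
      DerC σ P Γ (A ::ₘ Δ) → DerC σ P (A.neg ::ₘ Γ) Δ
  | rneg {Γ Δ : Multiset (Fml σ)} (A : Fml σ) :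
      DerC σ P (A ::ₘ Γ) Δ → DerC σ P Γ (A.neg ::ₘ Δ)
  | land {Γ Δ : Multiset (Fml σ)} (A B : Fml σ) :
      DerC σ P (A ::ₘ B ::ₘ Γ) Δ → DerC σ P ((A.conj B) ::ₘ Γ) Δ
  | rand {Γ Δ : Multiset (Fml σ)} (A B : Fml σ) :
      DerC σ P Γ (A ::ₘ Δ) → DerC σ P Γ (B ::ₘ Δ) →
      DerC σ P Γ ((A.conj B) ::ₘ Δ)
  | lor {Γ Δ : Multiset (Fml σ)} (A B : Fml σ) :
      DerC σ P (A ::ₘ Γ) Δ → DerC σ P (B ::ₘ Γ) Δ →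
      DerC σ P ((A.disj B) ::ₘ Γ) Δ
  | ror {Γ Δ : Multiset (Fml σ)} (A B : Fml σ) :
      DerC σ P Γ (A ::ₘ B ::ₘ Δ) → DerC σ P Γ ((A.disj B) ::ₘ Δ)
  | limp {Γ Δ : Multiset (Fml σ)} (A B : Fml σ) :
      DerC σ P Γ (A ::ₘ Δ) → DerC σ P (B ::ₘ Γ) Δ →
      DerC σ P ((A.imp B) ::ₘ Γ) Δ
  | rimp {Γ Δ : Multiset (Fml σ)} (A B : Fml σ) :
      DerC σ P (A ::ₘ Γ) (B ::ₘ Δ) → DerC σ P Γ ((A.imp B) ::ₘ Δ)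
  | lall {Γ Δ : Multiset (Fml σ)} (A : Fml σ) (t : Tm σ) :
      DerC σ P ((A.inst0 t) ::ₘ Γ) Δ → DerC σ P ((Fml.all A) ::ₘ Γ) Δ
  | rall {Γ Δ : Multiset (Fml σ)} (A : Fml σ) (a : ℕ) :
      FreshM a Γ → FreshM a Δ → a ∉ A.pars →
      DerC σ P Γ ((A.inst0 (.par a)) ::ₘ Δ) → DerC σ P Γ ((Fml.all A) ::ₘ Δ)
  | lex {Γ Δ : Multiset (Fml σ)} (A : Fml σ) (a : ℕ) :
      FreshM a Γ → FreshM a Δ → a ∉ A.pars →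
      DerC σ P ((A.inst0 (.par a)) ::ₘ Γ) Δ → DerC σ P ((Fml.ex A) ::ₘ Γ) Δ
  | rex {Γ Δ : Multiset (Fml σ)} (A : Fml σ) (t : Tm σ) :
      DerC σ P Γ ((A.inst0 t) ::ₘ Δ) → DerC σ P Γ ((Fml.ex A) ::ₘ Δ)
  | eqI {Γ Δ : Multiset (Fml σ)} (A : Fml σ) (t₁ t₂ : Tm σ) :
      A.Atomic →
      DerC σ P ((A.inst0 t₂) ::ₘ Γ) Δ →
      DerC σ P ((Fml.eq t₁ t₂) ::ₘ (A.inst0 t₁) ::ₘ Γ) Δ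
  | eqE {Γ Δ : Multiset (Fml σ)} (t : Tm σ) :
      DerC σ P ((Fml.eq t t) ::ₘ Γ) Δ → DerC σ P Γ Δ
  | riC {Γ Δ : Multiset (Fml σ)} (F G : Fml σ) (t : Tm σ) (a : ℕ) :
      FreshM a Γ → FreshM a Δ → a ∉ F.pars → a ∉ G.pars →
      DerC σ P Γ ((F.inst0 t) ::ₘ Δ) →
      DerC σ P Γ ((G.inst0 t) ::ₘ Δ) →
      DerC σ P ((F.inst0 (.par a)) ::ₘ Γ) ((Fml.eq (.par a) t) ::ₘ Δ) →
      DerC σ P Γ ((Fml.iq F G) ::ₘ Δ)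
  | liC1 {Γ Δ : Multiset (Fml σ)} (F G : Fml σ) (a : ℕ) :
      FreshM a Γ → FreshM a Δ → a ∉ F.pars → a ∉ G.pars →
      DerC σ P ((F.inst0 (.par a)) ::ₘ (G.inst0 (.par a)) ::ₘ Γ) Δ →
      DerC σ P ((Fml.iq F G) ::ₘ Γ) Δ
  | liC2 {Γ Δ : Multiset (Fml σ)} (F G A : Fml σ) (t₁ t₂ : Tm σ) :
      A.Atomic →
      DerC σ P Γ ((F.inst0 t₁) ::ₘ Δ) →
      DerC σ P Γ ((F.inst0 t₂) ::ₘ Δ) →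
      DerC σ P Γ ((A.inst0 t₂) ::ₘ Δ) →
      DerC σ P ((Fml.iq F G) ::ₘ Γ) ((A.inst0 t₁) ::ₘ Δ)

/-- The Russellian formula `∃y(∀x(F ↔ x = y) ∧ G[y/x])`, for formulas `F`,
`G` whose variable `x` is the de Bruijn index 0.  The variable `y` is the
one bound by the outer existential quantifier, so it does not occur in `F`
or `G`. -/
def SI1L {σ : Sig} (F G : Fml σ) : Fml σ :=
  Fml.ex (Fml.conj
    (Fml.all (Fml.iff (F.lift 1) (Fml.eq (.bvar 0) (.bvar 1)))) G)

namespace Tm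

variable {σ : Sig}

theorem inst_lift (k : ℕ) (u t : Tm σ) : inst k u (t.lift k) = t := by
  induction t with
  | par | const => rfl
  | bvar n =>
    rw [lift]
    split_ifs <;> simp only [inst] <;> grind
  | func f ts ih => simp only [lift, inst, ih]

theorem inst_par_comm {j k : ℕ} (h : j ≤ k) (a c : ℕ) (t : Tm σ) :
    inst j (par c) (inst (k + 1) (par a) t) = inst k (par a) (inst j (par c) t) := by
  induction t with
  | par | const => rfl
  | bvar n =>
    rcases lt_trichotomy n j with hn | rfl | hn
    · simp [inst, show n ≠ k + 1 by omega, show ¬ k + 1 < n by omega, show n ≠ j by omega,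
        show ¬ j < n by omega, show n ≠ k by omega, show ¬ k < n by omega]
    · simp [inst, show n ≠ k + 1 by omega, show ¬ k + 1 < n by omega]
    · rcases lt_trichotomy n (k + 1) with hk | rfl | hk
      · simp [inst, show n ≠ k + 1 by omega, show ¬ k + 1 < n by omega, show n ≠ j by omega,
          hn, show n - 1 ≠ k by omega, show ¬ k < n - 1 by omega]
      · simp [inst, show k + 1 ≠ j by omega, hn]
      · simp [inst, show n ≠ k + 1 by omega, hk, show n ≠ j by omega, hn,
          show n - 1 ≠ j by omega, show j < n - 1 by omega, show n - 1 ≠ k by omega,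
          show k < n - 1 by omega]
  | func f ts ih => simp only [inst, ih]

theorem pars_lift (k : ℕ) (t : Tm σ) : (t.lift k).pars = t.pars := by
  induction t with
  | par | const => rfl
  | bvar n =>
    rw [lift]
    split_ifs <;> rfl
  | func f ts ih => simp only [lift, pars, ih]

theorem pars_inst_subset (k : ℕ) (u t : Tm σ) : (inst k u t).pars ⊆ t.pars ∪ u.pars := by
  induction t with
  | par | const => exact Set.subset_union_left
  | bvar n =>
    rw [inst]
    split_ifs <;> simp [pars]
  | func f ts ih =>
    simp only [inst, pars]
    exact Set.iUnion_subset fun i => (ih i).trans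
      (Set.union_subset_union_left _ (Set.subset_iUnion (fun i => (ts i).pars) i))

theorem finite_pars (t : Tm σ) : t.pars.Finite := by
  induction t with
  | par a => exact Set.finite_singleton a
  | const | bvar => exact Set.finite_empty
  | func f ts ih => exact Set.finite_iUnion ih

end Tm

namespace Fml

variable {σ : Sig}

theorem inst_lift (k : ℕ) (u : Tm σ) (A : Fml σ) : (A.lift k).inst k u = A := by
  induction A generalizing k u <;> simp_all [lift, inst, Tm.inst_lift]

theorem inst_par_comm {j k : ℕ} (h : j ≤ k) (a c : ℕ) (A : Fml σ) :
    (A.inst (k + 1) (.par a)).inst j (.par c) = (A.inst j (.par c)).inst k (.par a) := by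
  induction A generalizing j k <;>
    simp_all [inst, Tm.lift, Tm.inst_par_comm]

theorem inst0_inst_one (a c : ℕ) (A : Fml σ) :
    (A.inst 1 (.par a)).inst0 (.par c) = (A.inst0 (.par c)).inst0 (.par a) :=
  inst_par_comm le_rfl a c A

theorem deg_inst (k : ℕ) (u : Tm σ) (A : Fml σ) : (A.inst k u).deg = A.deg := by
  induction A generalizing k u <;> simp_all [inst, deg]

theorem pars_lift (k : ℕ) (A : Fml σ) : (A.lift k).pars = A.pars := by
  induction A generalizing k <;> simp_all [lift, pars, Tm.pars_lift]

theorem pars_inst_subset (k : ℕ) (u : Tm σ) (A : Fml σ) :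
    (A.inst k u).pars ⊆ A.pars ∪ u.pars := by
  induction A generalizing k u with
  | atom p ts =>
    exact Set.iUnion_subset fun i => (Tm.pars_inst_subset k u (ts i)).trans
      (Set.union_subset_union_left u.pars (Set.subset_iUnion (fun i => (ts i).pars) i))
  | eq t s =>
    have ht := Tm.pars_inst_subset k u t
    have hs := Tm.pars_inst_subset k u s
    simp only [inst, pars]
    grind
  | neg A ih => exact ih k u
  | conj A B ihA ihB | disj A B ihA ihB | imp A B ihA ihB =>
    have hA := ihA k u
    have hB := ihB k u
    simp only [inst, pars]
    grind
  | all A ih | ex A ih =>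
    simpa only [inst, pars, Tm.pars_lift] using ih (k + 1) (u.lift 0)
  | iq F G ihF ihG =>
    have hF := ihF (k + 1) (u.lift 0)
    have hG := ihG (k + 1) (u.lift 0)
    rw [Tm.pars_lift] at hF hG
    simp only [inst, pars]
    grind

theorem notMem_pars_inst_par {a c : ℕ} {A : Fml σ} (k : ℕ) (hA : a ∉ A.pars) (hc : a ≠ c) :
    a ∉ (A.inst k (.par c)).pars :=
  fun h => (pars_inst_subset k _ A h).elim hA hc

theorem finite_pars (A : Fml σ) : A.pars.Finite := by
  induction A with
  | atom p ts => exact Set.finite_iUnion fun i => (ts i).finite_pars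
  | eq t s => exact t.finite_pars.union s.finite_pars
  | neg A ih | all A ih | ex A ih => exact ih
  | conj A B ihA ihB | disj A B ihA ihB | imp A B ihA ihB | iq A B ihA ihB => exact ihA.union ihB

theorem exists_fresh (A B : Fml σ) (S : Finset ℕ) : ∃ c, c ∉ A.pars ∧ c ∉ B.pars ∧ c ∉ S := by
  obtain ⟨c, hc⟩ := ((A.finite_pars.union B.finite_pars).union S.finite_toSet).exists_notMem
  simp only [Set.mem_union, Finset.mem_coe, not_or] at hc
  exact ⟨c, hc.1.1, hc.1.2, hc.2⟩

end Fml

namespace FreshM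

variable {σ : Sig}

theorem zero (a : ℕ) : FreshM a (0 : Multiset (Fml σ)) := by
  simp [FreshM]

theorem cons {a : ℕ} {A : Fml σ} {Γ : Multiset (Fml σ)} (hA : a ∉ A.pars) (hΓ : FreshM a Γ) :
    FreshM a (A ::ₘ Γ) := by
  simpa [FreshM] using ⟨hA, hΓ⟩

end FreshM

namespace DerC

variable {σ : Sig} {P : Fml σ → Prop} {Γ Γ' Δ Δ' : Multiset (Fml σ)}

theorem weaken_left (h : DerC σ P Γ Δ) (Θ : Multiset (Fml σ)) : DerC σ P (Θ + Γ) Δ := by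
  induction Θ using Multiset.induction with
  | empty => simpa using h
  | cons A Θ ih => simpa using ih.lw A

theorem weaken_right (h : DerC σ P Γ Δ) (Θ : Multiset (Fml σ)) : DerC σ P Γ (Θ + Δ) := by
  induction Θ using Multiset.induction with
  | empty => simpa using h
  | cons A Θ ih => simpa using ih.rw A

theorem contract_left_of_mem {A : Fml σ} (hA : A ∈ Γ) (h : DerC σ P (A ::ₘ Γ) Δ) :
    DerC σ P Γ Δ := by
  obtain ⟨Θ, rfl⟩ := Multiset.exists_cons_of_mem hA
  exact h.lc A

theorem contract_right_of_mem {A : Fml σ} (hA : A ∈ Δ) (h : DerC σ P Γ (A ::ₘ Δ)) :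
    DerC σ P Γ Δ := by
  obtain ⟨Θ, rfl⟩ := Multiset.exists_cons_of_mem hA
  exact h.rc A

theorem contract_left_of_subset (hΓ : Γ ⊆ Γ') (h : DerC σ P (Γ + Γ') Δ) : DerC σ P Γ' Δ := by
  induction Γ using Multiset.induction with
  | empty => simpa using h
  | cons A Γ ih =>
    rw [Multiset.cons_subset] at hΓ
    rw [Multiset.cons_add] at h
    exact ih hΓ.2 (contract_left_of_mem (Multiset.mem_add.2 (.inr hΓ.1)) h)

theorem contract_right_of_subset (hΔ : Δ ⊆ Δ') (h : DerC σ P Γ (Δ + Δ')) : DerC σ P Γ Δ' := by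
  induction Δ using Multiset.induction with
  | empty => simpa using h
  | cons A Δ ih =>
    rw [Multiset.cons_subset] at hΔ
    rw [Multiset.cons_add] at h
    exact ih hΔ.2 (contract_right_of_mem (Multiset.mem_add.2 (.inr hΔ.1)) h)

theorem mono (h : DerC σ P Γ Δ) (hΓ : Γ ⊆ Γ') (hΔ : Δ ⊆ Δ') : DerC σ P Γ' Δ' := by
  refine contract_left_of_subset hΓ (contract_right_of_subset hΔ ?_)
  have := (h.weaken_left Γ').weaken_right Δ'
  rwa [add_comm Γ', add_comm Δ'] at this

theorem ax_of_mem {A : Fml σ} (hΓ : A ∈ Γ) (hΔ : A ∈ Δ) : DerC σ P Γ Δ :=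
  (ax A).mono (by simpa using hΓ) (by simpa using hΔ)

theorem cut_shared (A : Fml σ) (hA : P A) (h₁ : DerC σ P Γ (A ::ₘ Δ))
    (h₂ : DerC σ P (A ::ₘ Γ) Δ) : DerC σ P Γ Δ :=
  (cut A h₁ h₂ hA).mono (fun _ h => by simpa using h)
    (fun _ h => by simpa using h)

theorem eq_refl_mem {t : Tm σ} (h : Fml.eq t t ∈ Δ) : DerC σ P Γ Δ :=
  eqE t (ax_of_mem (Multiset.mem_cons_self _ _) h)

theorem eq_symm (a b : ℕ) :
    DerC σ P {Fml.eq (.par a) (.par b)} {Fml.eq (.par b) (.par a)} := by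
  have h := eqI (P := P) (Γ := 0) (Fml.eq (.bvar 0) (.par a)) (.par a) (.par b) trivial (ax _)
  simp only [Fml.inst0, Fml.inst, Tm.inst, if_true] at h
  exact eqE (.par a) (h.mono (by simp) (by simp))

/-- Descriptions are unique: `Ix[F,G]`, `F[b/x]` and `F[a/x]` entail `b = a`. -/
theorem iq_unique (F G : Fml σ) (a b : ℕ)
    (h : Fml.iq F G ∈ Γ) (hΔ : Fml.eq (.par b) (.par a) ∈ Δ)
    (hb : DerC σ P Γ (F.inst0 (.par b) ::ₘ Δ)) (ha : DerC σ P Γ (F.inst0 (.par a) ::ₘ Δ)) :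
    DerC σ P Γ Δ := by
  refine contract_left_of_mem h (contract_right_of_mem hΔ ?_)
  have key := liC2 F G (Fml.eq (.bvar 0) (.par a)) (.par b) (.par a) trivial hb ha
    (eq_refl_mem (t := .par a) (Multiset.mem_cons_self _ _))
  simpa only [Fml.inst0, Fml.inst, Tm.inst, if_true] using key

/-- Replacement of equal parameters is derivable for all formulas of degree `n`. -/
def Leibniz (σ : Sig) (n : ℕ) : Prop :=
  ∀ A : Fml σ, A.deg = n → ∀ a b : ℕ,
    DerC σ (fun _ => True) {Fml.eq (.par a) (.par b), A.inst0 (.par a)} {A.inst0 (.par b)}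

namespace Leibniz

variable {A : Fml σ} {a b : ℕ}

theorem forward (h : Leibniz σ A.deg) (hab : Fml.eq (.par a) (.par b) ∈ Γ)
    (hΓ : A.inst0 (.par a) ∈ Γ) (hΔ : A.inst0 (.par b) ∈ Δ) :
    DerC σ (fun _ => True) Γ Δ :=
  (h A rfl a b).mono (by simp [Multiset.insert_eq_cons, Multiset.cons_subset, *])
    (by simpa using hΔ)

theorem backward (h : Leibniz σ A.deg) (hab : Fml.eq (.par a) (.par b) ∈ Γ)
    (hΓ : A.inst0 (.par b) ∈ Γ) (hΔ : A.inst0 (.par a) ∈ Δ) :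
    DerC σ (fun _ => True) Γ Δ := by
  refine cut_shared (Fml.eq (.par b) (.par a)) trivial
    ((eq_symm a b).mono (by simpa using hab) (by simp)) ?_
  exact h.forward (a := b) (b := a) (by simp) (by simp [hΓ]) hΔ

end Leibniz

theorem leibniz (n : ℕ) : Leibniz σ n := by
  induction n using Nat.strong_induction_on with
  | _ n ih =>
  rintro A rfl a b
  cases A with
  | atom p ts => exact eqI (Γ := 0) (Fml.atom p ts) (.par a) (.par b) trivial (ax _)
  | eq s t => exact eqI (Γ := 0) (Fml.eq s t) (.par a) (.par b) trivial (ax _)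
  | neg A =>
    have hA : Leibniz σ A.deg := ih _ (by simp [Fml.deg])
    refine rneg (A.inst0 (.par b)) (Δ := 0)
      (mono (lneg (Γ := {Fml.eq (.par a) (.par b), A.inst0 (.par b)}) (Δ := 0)
        (A.inst0 (.par a)) ?_) ?_ (fun _ h => h))
    · exact hA.backward (a := a) (b := b) (by simp) (by simp) (by simp)
    · intro X; simp [Fml.inst0, Fml.inst]; tauto
  | conj A B =>
    have hA : Leibniz σ A.deg := ih _ (by simp only [Fml.deg]; omega)
    have hB : Leibniz σ B.deg := ih _ (by simp only [Fml.deg]; omega)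
    refine mono (land (Γ := {Fml.eq (.par a) (.par b)}) (A.inst0 (.par a)) (B.inst0 (.par a))
      (rand (A.inst0 (.par b)) (B.inst0 (.par b)) (Δ := 0) ?_ ?_)) ?_ (fun _ h => h)
    · exact hA.forward (a := a) (b := b) (by simp) (by simp) (by simp)
    · exact hB.forward (a := a) (b := b) (by simp) (by simp) (by simp)
    · intro X; simp [Fml.inst0, Fml.inst]; tauto
  | disj A B =>
    have hA : Leibniz σ A.deg := ih _ (by simp only [Fml.deg]; omega)
    have hB : Leibniz σ B.deg := ih _ (by simp only [Fml.deg]; omega)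
    refine mono (ror (A.inst0 (.par b)) (B.inst0 (.par b)) (Δ := 0)
      (lor (Γ := {Fml.eq (.par a) (.par b)}) (A.inst0 (.par a)) (B.inst0 (.par a)) ?_ ?_))
      ?_ (fun _ h => h)
    · exact hA.forward (a := a) (b := b) (by simp) (by simp) (by simp)
    · exact hB.forward (a := a) (b := b) (by simp) (by simp) (by simp)
    · intro X; simp [Fml.inst0, Fml.inst]; tauto
  | imp A B =>
    have hA : Leibniz σ A.deg := ih _ (by simp only [Fml.deg]; omega)
    have hB : Leibniz σ B.deg := ih _ (by simp only [Fml.deg]; omega)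
    refine rimp (A.inst0 (.par b)) (B.inst0 (.par b)) (Δ := 0)
      (mono (limp (Γ := {Fml.eq (.par a) (.par b), A.inst0 (.par b)})
        (Δ := {B.inst0 (.par b)}) (A.inst0 (.par a)) (B.inst0 (.par a)) ?_ ?_)
        ?_ (fun _ h => h))
    · exact hA.backward (a := a) (b := b) (by simp) (by simp) (by simp)
    · exact hB.forward (a := a) (b := b) (by simp) (by simp) (by simp)
    · intro X; simp [Fml.inst0, Fml.inst]; tauto
  | all A =>
    obtain ⟨c, hcA, -, hc⟩ := A.exists_fresh A {a, b}
    simp only [Finset.mem_insert, Finset.mem_singleton, not_or] at hc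
    have hA : Leibniz σ (A.inst0 (.par c)).deg := ih _ (by simp [Fml.deg, Fml.inst0, Fml.deg_inst])
    refine rall (A.inst 1 (.par b)) c (Δ := 0) ?_ (.zero c)
      (Fml.notMem_pars_inst_par 1 hcA hc.2) ?_
    · exact .cons (by simp [Fml.pars, Tm.pars, hc])
        (.cons (Fml.notMem_pars_inst_par 0 (A := A.all) hcA hc.1) (.zero c))
    · refine mono (lall (Γ := {Fml.eq (.par a) (.par b)}) (A.inst 1 (.par a)) (.par c) ?_) ?_
        (fun _ h => h)
      · rw [Fml.inst0_inst_one, Fml.inst0_inst_one]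
        exact hA.forward (a := a) (b := b) (by simp) (by simp) (by simp)
      · intro X; simp [Fml.inst0, Fml.inst, Tm.lift]; tauto
  | ex A =>
    obtain ⟨c, hcA, -, hc⟩ := A.exists_fresh A {a, b}
    simp only [Finset.mem_insert, Finset.mem_singleton, not_or] at hc
    have hA : Leibniz σ (A.inst0 (.par c)).deg := ih _ (by simp [Fml.deg, Fml.inst0, Fml.deg_inst])
    refine mono (lex (Γ := {Fml.eq (.par a) (.par b)}) (A.inst 1 (.par a)) c ?_
      (Δ := {A.ex.inst0 (.par b)}) ?_ (Fml.notMem_pars_inst_par 1 hcA hc.1) ?_) ?_ (fun _ h => h)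
    · exact .cons (by simp [Fml.pars, Tm.pars, hc]) (.zero c)
    · exact .cons (Fml.notMem_pars_inst_par 0 (A := A.ex) hcA hc.2) (.zero c)
    · refine rex (A.inst 1 (.par b)) (.par c) (Δ := 0) ?_
      rw [Fml.inst0_inst_one, Fml.inst0_inst_one]
      exact hA.forward (a := a) (b := b) (by simp) (by simp) (by simp)
    · intro X; simp [Fml.inst0, Fml.inst, Tm.lift]; tauto
  | iq F G =>
    obtain ⟨c, hcF, hcG, hc⟩ := F.exists_fresh G {a, b}
    obtain ⟨d, hdF, hdG, hd⟩ := F.exists_fresh G {a, b, c}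
    simp only [Finset.mem_insert, Finset.mem_singleton, not_or] at hc hd
    have hF (e : ℕ) : Leibniz σ (F.inst0 (.par e)).deg :=
      ih _ (by simp only [Fml.deg, Fml.inst0, Fml.deg_inst]; omega)
    have hG (e : ℕ) : Leibniz σ (G.inst0 (.par e)).deg :=
      ih _ (by simp only [Fml.deg, Fml.inst0, Fml.deg_inst]; omega)
    have heq (e : ℕ) (h : e ≠ a ∧ e ≠ b) : e ∉ (Fml.eq (σ := σ) (.par a) (.par b)).pars := by
      simp [Fml.pars, Tm.pars, h]
    have hiq (e k : ℕ) (hF : e ∉ F.pars) (hG : e ∉ G.pars) (hk : e ≠ k) :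
        e ∉ ((Fml.iq F G).inst0 (.par k)).pars :=
      Fml.notMem_pars_inst_par 0 (by simp [Fml.pars, hF, hG]) hk
    refine contract_left_of_mem (A := (Fml.iq F G).inst0 (.par a)) (by simp) ?_
    refine liC1 (F.inst 1 (.par a)) (G.inst 1 (.par a)) c
      (.cons (heq c hc) (.cons (hiq c a hcF hcG hc.1) (.zero c)))
      (.cons (hiq c b hcF hcG hc.2) (.zero c))
      (Fml.notMem_pars_inst_par 1 hcF hc.1) (Fml.notMem_pars_inst_par 1 hcG hc.1) ?_
    rw [Fml.inst0_inst_one, Fml.inst0_inst_one]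
    refine riC (F.inst 1 (.par b)) (G.inst 1 (.par b)) (.par c) d (Δ := 0) ?_ (.zero d)
      (Fml.notMem_pars_inst_par 1 hdF hd.2.1) (Fml.notMem_pars_inst_par 1 hdG hd.2.1) ?_ ?_ ?_
    · have hd' (A : Fml σ) (hA : d ∉ A.pars) : d ∉ ((A.inst0 (.par c)).inst0 (.par a)).pars :=
        Fml.notMem_pars_inst_par 0 (Fml.notMem_pars_inst_par 0 hA hd.2.2) hd.1
      exact .cons (hd' F hdF) (.cons (hd' G hdG)
        (.cons (heq d ⟨hd.1, hd.2.1⟩) (.cons (hiq d a hdF hdG hd.1) (.zero d))))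
    · rw [Fml.inst0_inst_one]
      exact (hF c).forward (a := a) (b := b) (by simp) (by simp) (by simp)
    · rw [Fml.inst0_inst_one]
      exact (hG c).forward (a := a) (b := b) (by simp) (by simp) (by simp)
    · rw [Fml.inst0_inst_one]
      refine iq_unique (F.inst 1 (.par a)) (G.inst 1 (.par a)) c d
        (by simp [Fml.inst0, Fml.inst, Tm.lift]) (by simp) ?_ ?_
      · rw [Fml.inst0_inst_one]
        exact (hF d).backward (a := a) (b := b) (by simp) (by simp) (by simp)
      · rw [Fml.inst0_inst_one]
        exact ax_of_mem (A := (F.inst0 (.par c)).inst0 (.par a)) (by simp) (by simp)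

/-- Replacement of equals in an arbitrary formula. -/
theorem leibniz_of_mem (A : Fml σ) (a b : ℕ) (hab : Fml.eq (.par a) (.par b) ∈ Γ)
    (hΓ : A.inst0 (.par b) ∈ Γ) (hΔ : A.inst0 (.par a) ∈ Δ) :
    DerC σ (fun _ => True) Γ Δ :=
  (leibniz A.deg).backward hab hΓ hΔ

/-- The formula `F ↔ x = a` with free variable `x`. -/
def uniqueMatrix (F : Fml σ) (a : ℕ) : Fml σ :=
  Fml.iff F (Fml.eq (.bvar 0) (.par a))

theorem inst_matrix (F G : Fml σ) (a : ℕ) :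
    (Fml.conj (Fml.all (Fml.iff (F.lift 1) (Fml.eq (.bvar 0) (.bvar 1)))) G).inst0 (.par a) =
      Fml.conj (Fml.all (uniqueMatrix F a)) (G.inst0 (.par a)) := by
  simp [uniqueMatrix, Fml.iff, Fml.inst0, Fml.inst, Tm.inst, Tm.lift, Fml.inst_lift]

theorem inst_uniqueMatrix (F : Fml σ) (a b : ℕ) :
    (uniqueMatrix F a).inst0 (.par b) =
      Fml.conj (Fml.imp (F.inst0 (.par b)) (Fml.eq (.par b) (.par a)))
        (Fml.imp (Fml.eq (.par b) (.par a)) (F.inst0 (.par b))) := by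
  simp [uniqueMatrix, Fml.iff, Fml.inst0, Fml.inst, Tm.inst]

theorem notMem_pars_SI1L {F G : Fml σ} {a : ℕ} (hF : a ∉ F.pars) (hG : a ∉ G.pars) :
    a ∉ (SI1L F G).pars := by
  simp [SI1L, Fml.iff, Fml.pars, Tm.pars, Fml.pars_lift, hF, hG]

theorem notMem_pars_uniqueMatrix {F : Fml σ} {a b : ℕ} (hF : b ∉ F.pars) (hb : b ≠ a) :
    b ∉ (uniqueMatrix F a).pars := by
  simp [uniqueMatrix, Fml.iff, Fml.pars, Tm.pars, hF, hb]

theorem iq_imp_SI1L (F G : Fml σ) :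
    DerC σ (fun _ => True) {Fml.iq F G} {SI1L F G} := by
  obtain ⟨a, haF, haG, -⟩ := F.exists_fresh G ∅
  obtain ⟨b, hbF, hbG, hb⟩ := F.exists_fresh G {a}
  rw [Finset.mem_singleton] at hb
  have hiq (e : ℕ) (hF : e ∉ F.pars) (hG : e ∉ G.pars) : e ∉ (Fml.iq F G).pars := by
    simp [Fml.pars, hF, hG]
  refine contract_left_of_mem (A := Fml.iq F G) (by simp) ?_
  refine liC1 F G a (.cons (hiq a haF haG) (.zero a))
    (.cons (notMem_pars_SI1L haF haG) (.zero a)) haF haG ?_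
  refine rex _ (.par a) (Δ := 0) ?_
  rw [inst_matrix]
  refine rand _ _ (rall _ b ?_ (.zero b) (notMem_pars_uniqueMatrix hbF hb) ?_)
    (ax_of_mem (A := G.inst0 (.par a)) (by simp) (by simp))
  · exact .cons (Fml.notMem_pars_inst_par 0 hbF hb)
      (.cons (Fml.notMem_pars_inst_par 0 hbG hb) (.cons (hiq b hbF hbG) (.zero b)))
  · rw [inst_uniqueMatrix]
    refine rand _ _ (rimp _ _ ?_) (rimp _ _ ?_)
    · exact iq_unique F G a b (by simp) (by simp)
        (ax_of_mem (A := F.inst0 (.par b)) (by simp) (by simp))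
        (ax_of_mem (A := F.inst0 (.par a)) (by simp) (by simp))
    · exact leibniz_of_mem F b a (by simp) (by simp) (by simp)

theorem SI1L_imp_iq (F G : Fml σ) :
    DerC σ P {SI1L F G} {Fml.iq F G} := by
  obtain ⟨a, haF, haG, -⟩ := F.exists_fresh G ∅
  obtain ⟨b, hbF, hbG, hb⟩ := F.exists_fresh G {a}
  rw [Finset.mem_singleton] at hb
  refine lex _ a (Γ := 0) (.zero a)
    (.cons (by simp [Fml.pars, haF, haG]) (.zero a)) (notMem_pars_SI1L haF haG) ?_
  rw [inst_matrix]
  refine land _ _ (riC F G (.par a) b (Δ := 0) ?_ (.zero b) hbF hbG ?_ ?_ ?_)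
  · exact .cons (notMem_pars_uniqueMatrix hbF hb)
      (.cons (Fml.notMem_pars_inst_par 0 hbG hb) (.zero b))
  · refine lall _ (.par a) ?_
    rw [inst_uniqueMatrix]
    refine land _ _ (lw _ (limp _ _ (eq_refl_mem (t := .par a) (by simp)) ?_))
    exact ax_of_mem (A := F.inst0 (.par a)) (by simp) (by simp)
  · exact ax_of_mem (A := G.inst0 (.par a)) (by simp) (by simp)
  · rw [Multiset.cons_swap]
    refine lall _ (.par b) ?_
    rw [inst_uniqueMatrix]
    refine land _ _ (limp _ _ ?_ ?_)
    · exact ax_of_mem (A := F.inst0 (.par b)) (by simp) (by simp)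
    · exact ax_of_mem (A := Fml.eq (.par b) (.par a)) (by simp) (by simp)

end DerC

/-- In the classical sequent calculus with identity extended by the rules
(RI^C), (LI^{C1}), (LI^{C2}) for `I`, for all formulas `F`, `G` the sequent
(with empty antecedent) `⇒ Ix[F,G] ↔ ∃y(∀x(F ↔ x = y) ∧ G[y/x])` is
provable. -/
theorem russellian_equivalence_classical {σ : Sig} (F G : Fml σ) :
    DerC σ (fun _ => True) 0 {Fml.iff (Fml.iq F G) (SI1L F G)} := by
  exact .rand _ _ (Δ := 0) (.rimp _ _ (DerC.iq_imp_SI1L F G)) (.rimp _ _ (DerC.SI1L_imp_iq F G))
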